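/- arXiv:1410.2927 — 3 statements merged into one kernel-verified Lean document; each statement's English description precedes it below -/
import Mathlib

section
/- For every real number θ > 1, the set A_θ has natural density 0; that is, |A_θ ∩ [1, N]| / N → 0 as N → ∞. -/
/-- The set of atypical numbers `A_θ`, defined via `M'_θ(n) = ⌊1/(θ^{1/n} - 1)⌋`. -/
noncomputable def Atheta (θ : ℝ) : Set ℕ :=
  {n | 0 < n ∧ ⌊(θ ^ ((n : ℝ))⁻¹ - 1)⁻¹⌋ ≠ ⌊(n : ℝ) / Real.log θ - 1 / 2⌋}

open Filter Topology

/-- A set of naturals whose gaps eventually exceed every bound has natural density zero. -/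
theorem tendsto_ncard_div_of_gaps (A : Set ℕ)
    (h : ∀ K : ℕ, 0 < K → ∃ n₀ : ℕ, ∀ a ∈ A, ∀ b ∈ A, n₀ ≤ a → a < b → K ≤ b - a) :
    Tendsto (fun N : ℕ => ((A ∩ Set.Icc 1 N).ncard : ℝ) / N) atTop (𝓝 0) := by
  have card_le (K n₀ : ℕ) (hK : 0 < K)
      (hgap : ∀ a ∈ A, ∀ b ∈ A, n₀ ≤ a → a < b → K ≤ b - a) (N : ℕ) :
      (A ∩ Set.Icc 1 N).ncard ≤ n₀ + (N / K + 1) := by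
    have hsub : A ∩ Set.Icc 1 N ⊆ (Finset.range n₀ : Set ℕ) ∪ (A ∩ Set.Icc n₀ N) := by
      rintro a ⟨haA, ha⟩
      by_cases hlt : a < n₀
      · left; simpa using hlt
      · right; exact ⟨haA, not_lt.mp hlt, ha.2⟩
    have hfin : (A ∩ Set.Icc n₀ N).Finite := (Set.finite_Icc n₀ N).inter_of_right A
    have hlarge : (A ∩ Set.Icc n₀ N).ncard ≤ N / K + 1 := by
      have hle : (A ∩ Set.Icc n₀ N).ncard ≤ (Finset.range (N / K + 1) : Set ℕ).ncard := by
        refine Set.ncard_le_ncard_of_injOn (fun a => a / K) ?_ ?_ (Finset.finite_toSet _)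
        · rintro a ⟨-, ha⟩
          simpa [Nat.lt_succ_iff] using Nat.div_le_div_right (c := K) ha.2
        · have no_lt : ∀ a ∈ A, ∀ b ∈ A, n₀ ≤ a → a / K = b / K → ¬ a < b := by
            intro a ha b hb hn hab hlt
            have hg := hgap a ha b hb hn hlt
            have hs : (a + K) / K ≤ b / K := Nat.div_le_div_right (by omega)
            rw [Nat.add_div_right _ hK] at hs
            omega
          rintro a ⟨haA, ha⟩ b ⟨hbA, hb⟩ hab
          have h1 := no_lt a haA b hbA ha.1 hab
          have h2 := no_lt b hbA a haA hb.1 hab.symm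
          omega
      rwa [Set.ncard_coe_finset, Finset.card_range] at hle
    calc (A ∩ Set.Icc 1 N).ncard
        ≤ ((Finset.range n₀ : Set ℕ) ∪ (A ∩ Set.Icc n₀ N)).ncard :=
          Set.ncard_le_ncard hsub ((Finset.finite_toSet _).union hfin)
      _ ≤ (Finset.range n₀ : Set ℕ).ncard + (A ∩ Set.Icc n₀ N).ncard := Set.ncard_union_le _ _
      _ ≤ n₀ + (N / K + 1) := by
          rw [Set.ncard_coe_finset, Finset.card_range]
          exact Nat.add_le_add_left hlarge _
  rw [Metric.tendsto_atTop]
  intro ε hε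
  obtain ⟨k, hk⟩ := exists_nat_one_div_lt (half_pos hε)
  obtain ⟨n₀, hn₀⟩ := h (k + 1) k.succ_pos
  obtain ⟨N₀, hN₀⟩ := exists_nat_gt (((n₀ : ℝ) + 1) / (ε / 2))
  refine ⟨N₀ + 1, fun N hN => ?_⟩
  have hNpos : (0 : ℝ) < N := by exact_mod_cast (by omega : 0 < N)
  have hNN : (N₀ : ℝ) ≤ N := by exact_mod_cast (by omega : N₀ ≤ N)
  have hcard : ((A ∩ Set.Icc 1 N).ncard : ℝ) ≤ n₀ + ((N / (k + 1) : ℕ) + 1) := by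
    exact_mod_cast card_le (k + 1) n₀ k.succ_pos hn₀ N
  have hdiv : ((N / (k + 1) : ℕ) : ℝ) ≤ N * (1 / ((k : ℝ) + 1)) := by
    have := Nat.cast_div_le (α := ℝ) (m := N) (n := k + 1)
    push_cast at this
    rwa [mul_one_div]
  have hmul : (N : ℝ) * (1 / ((k : ℝ) + 1)) < N * (ε / 2) := mul_lt_mul_of_pos_left hk hNpos
  have hconst : (n₀ : ℝ) + 1 < N * (ε / 2) := (div_lt_iff₀ (half_pos hε)).mp (hN₀.trans_le hNN)
  rw [Real.dist_eq, sub_zero, abs_of_nonneg (by positivity), div_lt_iff₀ hNpos]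
  linarith

theorem inv_sub_half_le_inv_exp_sub_one {x : ℝ} (hx : 0 < x) (hx1 : x ≤ 1) :
    1 / x - 1 / 2 ≤ (Real.exp x - 1)⁻¹ := by
  have hexp : Real.exp x ≤ 1 + x + x ^ 2 / 2 + x ^ 3 * (2 / 9) := by
    have h := Real.exp_bound' hx.le hx1 (n := 3) (by norm_num)
    norm_num [Finset.sum_range_succ, Nat.factorial] at h
    linarith
  have hpos : 0 < Real.exp x - 1 := by linarith [Real.add_one_lt_exp hx.ne']
  rw [← one_div, div_sub_div _ _ hx.ne' two_ne_zero, div_le_div_iff₀ (by positivity) hpos]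
  have hmul := mul_le_mul_of_nonneg_left hexp (by linarith : 0 ≤ 2 - x)
  nlinarith [pow_pos hx 3, pow_pos hx 4]

theorem inv_exp_sub_one_le {x : ℝ} (hx : 0 < x) :
    (Real.exp x - 1)⁻¹ ≤ 1 / x - 1 / 2 + x / 4 := by
  have hexp := Real.quadratic_le_exp_of_nonneg hx.le
  calc (Real.exp x - 1)⁻¹ ≤ (x + x ^ 2 / 2)⁻¹ := inv_anti₀ (by positivity) (by linarith)
    _ ≤ 1 / x - 1 / 2 + x / 4 := by
      rw [inv_le_iff_one_le_mul₀ (by positivity)]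
      have : (1 / x - 1 / 2 + x / 4) * (x + x ^ 2 / 2) = 1 + x ^ 3 / 8 := by
        field_simp
        ring
      rw [this]
      linarith [pow_pos hx 3]

/-- For large atypical `n`, the number `n / log θ - 1 / 2` lies just below an integer. -/
theorem exists_int_near_of_mem_Atheta {θ : ℝ} (hθ : 1 < θ) {ε : ℝ} (hε : 0 < ε) :
    ∃ n₀ : ℕ, ∀ n ∈ Atheta θ, n₀ ≤ n →
      ∃ m : ℤ, 0 < m - (n / Real.log θ - 1 / 2) ∧ m - (n / Real.log θ - 1 / 2) < ε := by
  have hL : 0 < Real.log θ := Real.log_pos hθ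
  have hlim : Tendsto (fun n : ℕ => Real.log θ / n) atTop (𝓝 0) :=
    tendsto_const_div_atTop_nhds_zero_nat _
  obtain ⟨n₀, hn₀⟩ := eventually_atTop.mp
    (hlim.eventually (gt_mem_nhds (lt_min one_pos hε)))
  refine ⟨n₀, fun n hn hle => ?_⟩
  obtain ⟨hnpos, hne⟩ := hn
  have hnR : (0 : ℝ) < n := by exact_mod_cast hnpos
  have hx := lt_min_iff.mp (hn₀ n hle)
  have hx0 : 0 < Real.log θ / n := by positivity
  have hlow := inv_sub_half_le_inv_exp_sub_one hx0 hx.1.le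
  have hupp := inv_exp_sub_one_le hx0
  rw [one_div_div] at hlow hupp
  rw [Real.rpow_def_of_pos (by linarith), ← div_eq_mul_inv] at hne
  have hlt := lt_of_le_of_ne (Int.floor_le_floor hlow) hne.symm
  refine ⟨⌊(Real.exp (Real.log θ / n) - 1)⁻¹⌋, ?_, ?_⟩
  · linarith [Int.floor_lt.mp hlt]
  · linarith [Int.floor_le (Real.exp (Real.log θ / n) - 1)⁻¹, hx.2]

theorem Irrational.exists_pos_le_abs_mul_sub_int {α : ℝ} (hα : Irrational α) (K : ℕ) :
    ∃ ε > 0, ∀ d : ℕ, 0 < d → d < K → ∀ z : ℤ, ε ≤ |d * α - z| := by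
  induction K with
  | zero => exact ⟨1, one_pos, fun d _ hd => absurd hd d.not_lt_zero⟩
  | succ K ih =>
    obtain ⟨ε, hε, h⟩ := ih
    rcases K.eq_zero_or_pos with rfl | hK
    · exact ⟨1, one_pos, fun d hd hd' => by omega⟩
    refine ⟨min ε |K * α - round (K * α)|, lt_min hε (abs_pos.mpr ?_), fun d hd hdK z => ?_⟩
    · exact sub_ne_zero.mpr ((hα.natCast_mul hK.ne').ne_int _)
    · rcases Nat.lt_succ_iff_lt_or_eq.mp hdK with hlt | rfl
      · exact (min_le_left _ _).trans (h d hd hlt z)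
      · exact (min_le_right _ _).trans (round_le _ z)

theorem Rat.exists_pos_le_int_sub (q : ℚ) :
    ∃ ε : ℝ, 0 < ε ∧ ∀ (n : ℕ) (m : ℤ), 0 < (m : ℝ) - (n * q - 1 / 2) →
      ε ≤ m - (n * q - 1 / 2) := by
  have hd : (0 : ℝ) < q.den := by exact_mod_cast q.den_pos
  refine ⟨1 / (2 * q.den), by positivity, fun n m h => ?_⟩
  have heq : (m : ℝ) - (n * q - 1 / 2)
      = ((2 * q.den * m - 2 * n * q.num + q.den : ℤ) : ℝ) / (2 * q.den) := by
    rw [Rat.cast_def]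
    push_cast
    field_simp
    ring
  rw [heq] at h ⊢
  have hnum := (div_pos_iff_of_pos_right (by positivity)).mp h
  have hone : (1 : ℤ) ≤ 2 * q.den * m - 2 * n * q.num + q.den := by
    exact_mod_cast hnum
  gcongr
  exact_mod_cast hone

theorem stmt2 (θ : ℝ) (hθ : 1 < θ) :
    Filter.Tendsto (fun N : ℕ => ((Atheta θ ∩ Set.Icc 1 N).ncard : ℝ) / N)
      Filter.atTop (nhds 0) := by
  refine tendsto_ncard_div_of_gaps _ fun K _ => ?_
  by_cases hα : Irrational (Real.log θ)⁻¹
  · obtain ⟨ε, hε, hfar⟩ := hα.exists_pos_le_abs_mul_sub_int K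
    obtain ⟨n₀, hn₀⟩ := exists_int_near_of_mem_Atheta hθ hε
    refine ⟨n₀, fun a ha b hb hna hab => ?_⟩
    by_contra! hlt
    obtain ⟨m, hm, hmε⟩ := hn₀ a ha hna
    obtain ⟨k, hk, hkε⟩ := hn₀ b hb (hna.trans hab.le)
    have hge := hfar (b - a) (by omega) hlt (k - m)
    refine hge.not_gt (abs_lt.mpr ?_)
    push_cast [Nat.cast_sub hab.le]
    rw [div_eq_mul_inv] at hm hmε hk hkε
    constructor <;> linarith
  · obtain ⟨q, hq⟩ := not_not.mp hα
    obtain ⟨ε, hε, hfar⟩ := q.exists_pos_le_int_sub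
    obtain ⟨n₀, hn₀⟩ := exists_int_near_of_mem_Atheta hθ hε
    refine ⟨n₀, fun a ha b hb hna hab => ?_⟩
    obtain ⟨m, hm, hmε⟩ := hn₀ a ha hna
    rw [div_eq_mul_inv, ← hq] at hm hmε
    exact absurd (hfar a m hm) hmε.not_ge
end

section
/- Let ℓ be an irrational real number with 0 < ℓ < 1 whose simple continued fraction expansion ℓ = [0; a₁, a₂, …] has positive integer partial quotients satisfying a₁ = 2 and a_{2k} = 4 for all k ≥ 1, and set θ = e^{2/ℓ}. Then A_θ is infinite. -/
/-- The iterates of the continued fraction (Gauss) algorithm on `ℓ`: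
`x₀ = ℓ`, `x_{k+1} = 1/{x_k}`. -/
noncomputable def cfX (ℓ : ℝ) : ℕ → ℝ
  | 0 => ℓ
  | k + 1 => (Int.fract (cfX ℓ k))⁻¹

/-- The `k`-th partial quotient of the simple continued fraction of `ℓ`:
`a_k = ⌊x_k⌋`, so `ℓ = [a₀; a₁, a₂, …]`. -/
noncomputable def cfA (ℓ : ℝ) (k : ℕ) : ℤ := ⌊cfX ℓ k⌋

theorem exp_sub_one_le_div_sq {x : ℝ} (hx : 0 < x) (hx1 : x ≤ 1) :
    Real.exp x - 1 ≤ x / (1 - x / 4) ^ 2 := by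
  have h := Real.exp_bound' hx.le hx1 (n := 4) (by norm_num)
  norm_num [Finset.sum_range_succ, Nat.factorial] at h
  have h4 : 0 < (1 - x / 4) ^ 2 := by
    have : 0 < 1 - x / 4 := by linarith
    positivity
  have hpoly : x + x ^ 2 / 2 + x ^ 3 / 6 + x ^ 4 * (5 / 96) ≤ x / (1 - x / 4) ^ 2 := by
    rw [le_div_iff₀ h4]
    have key : x - (x + x ^ 2 / 2 + x ^ 3 / 6 + x ^ 4 * (5 / 96)) * (1 - x / 4) ^ 2
        = x ^ 3 * (1 / 48 + x ^ 2 * (1 - x / 4) * (5 / 384)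
            + x ^ 2 * (1 / 384)) := by
      ring
    have : 0 ≤ x ^ 3 * (1 / 48 + x ^ 2 * (1 - x / 4) * (5 / 384)
            + x ^ 2 * (1 / 384)) := by
      have : 0 ≤ 1 - x / 4 := by linarith
      positivity
    linarith
  linarith

theorem le_inv_exp_sub_one {x : ℝ} (hx : 0 < x) (hx1 : x ≤ 1) :
    x⁻¹ - 1 / 2 + x / 16 ≤ (Real.exp x - 1)⁻¹ := by
  have hpos : 0 < Real.exp x - 1 := by linarith [Real.add_one_lt_exp hx.ne']
  calc x⁻¹ - 1 / 2 + x / 16 = (x / (1 - x / 4) ^ 2)⁻¹ := by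
        field_simp
        ring
    _ ≤ (Real.exp x - 1)⁻¹ := inv_anti₀ hpos (exp_sub_one_le_div_sq hx hx1)

/-- A good rational approximation of `ℓ` from above with odd numerator has an atypical
denominator. -/
theorem mem_Atheta_of_approx {ℓ : ℝ} (h0 : 0 < ℓ) (h1 : ℓ < 1) {n : ℕ} {p : ℤ} (hp : Odd p)
    (hn : 2 / ℓ ≤ n) (hpos : 0 < p - n * ℓ) (hle : 4 * n * (p - n * ℓ) ≤ 1) :
    n ∈ Atheta (Real.exp (2 / ℓ)) := by
  obtain ⟨m, rfl⟩ := hp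
  have hn0 : (0 : ℝ) < n := lt_of_lt_of_le (by positivity) hn
  refine ⟨by exact_mod_cast hn0, ?_⟩
  rw [Real.log_exp, ← Real.exp_mul]
  push_cast at hpos hle
  have hx : 0 < 2 / ℓ * (n : ℝ)⁻¹ := by positivity
  have hx1 : 2 / ℓ * (n : ℝ)⁻¹ ≤ 1 := by
    rw [← div_eq_mul_inv, div_le_one hn0]
    exact hn
  have hlow := le_inv_exp_sub_one hx hx1
  have hinv : (2 / ℓ * (n : ℝ)⁻¹)⁻¹ = n * ℓ / 2 := by
    field_simp
  have hdiv : (n : ℝ) / (2 / ℓ) = n * ℓ / 2 := by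
    field_simp
  rw [hinv] at hlow
  rw [hdiv]
  have hgap : (2 * m + 1 - n * ℓ : ℝ) ≤ 2 / ℓ * (n : ℝ)⁻¹ / 8 := by
    have h2 : (2 * m + 1 - n * ℓ : ℝ) ≤ (n : ℝ)⁻¹ / 4 := by
      rw [inv_eq_one_div, div_div, le_div_iff₀ (by positivity)]
      linarith
    have h3 : (2 : ℝ) ≤ 2 / ℓ := by
      rw [le_div_iff₀ h0]
      linarith
    have h4 := mul_le_mul_of_nonneg_right h3 (inv_pos.2 hn0).le
    linarith
  have hm : m ≤ ⌊(Real.exp (2 / ℓ * (n : ℝ)⁻¹) - 1)⁻¹⌋ := Int.le_floor.2 (by linarith)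
  have hm' : ⌊(n : ℝ) * ℓ / 2 - 1 / 2⌋ < m := Int.floor_lt.2 (by linarith)
  exact (hm'.trans_le hm).ne'

theorem irrational_fract {x : ℝ} (hx : Irrational x) : Irrational (Int.fract x) :=
  hx.sub_intCast ⌊x⌋

theorem irrational_cfX {ℓ : ℝ} (hℓ : Irrational ℓ) : ∀ k, Irrational (cfX ℓ k)
  | 0 => hℓ
  | k + 1 => (irrational_fract (irrational_cfX hℓ k)).inv

theorem one_lt_cfX_succ {ℓ : ℝ} (hℓ : Irrational ℓ) (k : ℕ) : 1 < cfX ℓ (k + 1) :=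
  one_lt_inv_iff₀.2 ⟨lt_of_le_of_ne (Int.fract_nonneg _)
    (irrational_fract (irrational_cfX hℓ k)).ne_zero.symm, Int.fract_lt_one _⟩

theorem cfX_eq_add_inv (ℓ : ℝ) (k : ℕ) : cfX ℓ k = cfA ℓ k + (cfX ℓ (k + 1))⁻¹ := by
  simp [cfX, cfA]

theorem one_le_cfA_succ {ℓ : ℝ} (hℓ : Irrational ℓ) (k : ℕ) : 1 ≤ cfA ℓ (k + 1) :=
  Int.le_floor.2 (by simpa using (one_lt_cfX_succ hℓ k).le)

/-- Convergents of odd index have odd numerators, those of even index even ones. -/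
theorem exists_convergents {ℓ : ℝ} (hirr : Irrational ℓ) (h0 : 0 < ℓ) (h1 : ℓ < 1)
    (ha1 : cfA ℓ 1 = 2) (heven : ∀ k : ℕ, 1 ≤ k → cfA ℓ (2 * k) = 4) (k : ℕ) :
    ∃ p p' q q' : ℤ, Odd p ∧ Even p' ∧ (k : ℤ) < q ∧ 0 < q' ∧ p * q' - p' * q = 1 ∧
      ℓ * (q * cfX ℓ (2 * k + 2) + q') = p * cfX ℓ (2 * k + 2) + p' := by
  induction k with
  | zero =>
    refine ⟨1, 0, 2, 1, odd_one, Even.zero, by norm_num, one_pos, by norm_num, ?_⟩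
    have hx := one_lt_cfX_succ hirr 1
    have hy := cfX_eq_add_inv ℓ 1
    have hℓ : cfX ℓ 1 = ℓ⁻¹ := by
      simp [cfX, Int.fract_eq_self.2 ⟨h0.le, h1⟩]
    rw [ha1, hℓ] at hy
    norm_num at hx hy ⊢
    have : cfX ℓ 2 ≠ 0 := by positivity
    field_simp at hy
    linarith
  | succ k ih =>
    obtain ⟨p, p', q, q', hp, hp', hq, hq', hdet, heq⟩ := ih
    have hb := one_le_cfA_succ hirr (2 * k + 2)
    set b := cfA ℓ (2 * k + 2 + 1) with hbdef
    refine ⟨b * (4 * p + p') + p, 4 * p + p', b * (4 * q + q') + q, 4 * q + q',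
      ?_, ?_, ?_, ?_, ?_, ?_⟩
    · exact (((Even.mul_right (by decide) p).add hp').mul_left b).add_odd hp
    · exact (Even.mul_right (by decide) p).add hp'
    · push_cast
      nlinarith
    · linarith
    · linear_combination hdet
    · have hx := cfX_eq_add_inv ℓ (2 * k + 2)
      have hy := cfX_eq_add_inv ℓ (2 * k + 2 + 1)
      have hy1 := one_lt_cfX_succ hirr (2 * k + 2)
      have hz1 := one_lt_cfX_succ hirr (2 * k + 2 + 1)
      have h4 : cfA ℓ (2 * k + 2) = 4 := heven (k + 1) (by omega)
      rw [h4] at hx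
      rw [← hbdef] at hy
      rw [show 2 * (k + 1) + 2 = 2 * k + 2 + 1 + 1 by ring]
      generalize cfX ℓ (2 * k + 2) = x at *
      generalize cfX ℓ (2 * k + 2 + 1) = y at *
      generalize cfX ℓ (2 * k + 2 + 1 + 1) = z at *
      have hxy : x * y = 4 * y + 1 := by
        rw [hx]
        push_cast
        field_simp
      have hyz : y * z = b * z + 1 := by
        rw [hy]
        field_simp
      push_cast
      linear_combination y * z * heq - (ℓ * q - p) * z * hxy
        - (ℓ * (4 * q + q') - (4 * p + p')) * hyz

theorem stmt6 (ℓ : ℝ) (hirr : Irrational ℓ) (h0 : 0 < ℓ) (h1 : ℓ < 1)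
    (ha1 : cfA ℓ 1 = 2) (heven : ∀ k : ℕ, 1 ≤ k → cfA ℓ (2 * k) = 4)
    (θ : ℝ) (hθ : θ = Real.exp (2 / ℓ)) :
    (Atheta θ).Infinite := by
  subst hθ
  refine Set.infinite_of_forall_exists_gt fun a => ?_
  obtain ⟨p, p', q, q', hp, -, hq, hq', hdet, heq⟩ :=
    exists_convergents hirr h0 h1 ha1 heven (max a ⌈2 / ℓ⌉₊)
  have hx : 4 ≤ cfX ℓ (2 * max a ⌈2 / ℓ⌉₊ + 2) := by
    have h4 : cfA ℓ (2 * max a ⌈2 / ℓ⌉₊ + 2) = 4 := heven (max a ⌈2 / ℓ⌉₊ + 1) (by omega)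
    exact_mod_cast Int.le_floor.1 h4.ge
  generalize cfX ℓ (2 * max a ⌈2 / ℓ⌉₊ + 2) = x at *
  lift q to ℕ using by omega
  have hq : max a ⌈2 / ℓ⌉₊ < q := by exact_mod_cast hq
  refine ⟨q, ?_, (le_max_left _ _).trans_lt hq⟩
  have hqR : (0 : ℝ) < q := by exact_mod_cast (Nat.zero_le _).trans_lt hq
  have hq'R : (0 : ℝ) < q' := by exact_mod_cast hq'
  have hdetR : (p : ℝ) * q' - p' * q = 1 := by exact_mod_cast hdet
  push_cast at heq
  have hD : 0 < (q : ℝ) * x + q' := by positivity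
  have hgap : (p : ℝ) - q * ℓ = 1 / (q * x + q') := by
    rw [eq_div_iff hD.ne']
    linear_combination hdetR - q * heq
  apply mem_Atheta_of_approx h0 h1 hp
  · exact (Nat.le_ceil _).trans (by exact_mod_cast (le_max_right _ _).trans hq.le)
  · rw [hgap]
    positivity
  · rw [hgap, mul_one_div, div_le_one hD]
    nlinarith
end

section
/- Let θ > 1 be real and n a positive integer. Then n ∈ A_θ if and only if both {2n/log θ} ≥ 1 − 2f(log θ / n) and {n/log θ} < 1 − f(log θ / n), where {·} denotes the fractional part. -/
/-- `f(t) = 1/(e^t - 1) - 1/t + 1/2`. -/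
noncomputable def f (t : ℝ) : ℝ := (Real.exp t - 1)⁻¹ - t⁻¹ + 1 / 2

lemma two_mul_exp_sub_one_le {t : ℝ} (ht : 0 ≤ t) :
    2 * (Real.exp t - 1) ≤ t * (Real.exp t + 1) := by
  have hd : ∀ x : ℝ, HasDerivAt (fun x => x * (Real.exp x + 1) - 2 * (Real.exp x - 1))
      (1 * (Real.exp x + 1) + x * Real.exp x - 2 * Real.exp x) x := fun x =>
    ((hasDerivAt_id x).mul ((Real.hasDerivAt_exp x).add_const 1)).sub
      (((Real.hasDerivAt_exp x).sub_const 1).const_mul 2)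
  have hmono : Monotone (fun x => x * (Real.exp x + 1) - 2 * (Real.exp x - 1)) := by
    refine monotone_of_deriv_nonneg (fun x => (hd x).differentiableAt) fun x => ?_
    rw [(hd x).deriv]
    have h := mul_le_mul_of_nonneg_left (Real.add_one_le_exp (-x)) (Real.exp_pos x).le
    rw [← Real.exp_add, add_neg_cancel, Real.exp_zero] at h
    linarith
  have h := hmono ht
  simp only [Real.exp_zero] at h
  linarith

lemma f_nonneg {t : ℝ} (ht : 0 < t) : 0 ≤ f t := by
  have he : 0 < Real.exp t - 1 := by linarith [Real.add_one_lt_exp ht.ne']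
  have hf : f t = (t * (Real.exp t + 1) - 2 * (Real.exp t - 1)) / (2 * t * (Real.exp t - 1)) := by
    unfold f
    field_simp
    ring
  rw [hf]
  exact div_nonneg (sub_nonneg.2 (two_mul_exp_sub_one_le ht.le)) (by positivity)

lemma f_lt_half {t : ℝ} (ht : 0 < t) : f t < 1 / 2 := by
  have h : (Real.exp t - 1)⁻¹ < t⁻¹ :=
    inv_strictAnti₀ ht (by linarith [Real.add_one_lt_exp ht.ne'])
  unfold f
  linarith

lemma floor_sub_half_add_ne_iff {x c : ℝ} (hc₀ : 0 ≤ c) (hc : c < 1 / 2) :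
    ⌊x - 1 / 2 + c⌋ ≠ ⌊x - 1 / 2⌋ ↔
      1 - 2 * c ≤ Int.fract (2 * x) ∧ Int.fract x < 1 - c := by
  have hx := Int.floor_add_fract x
  have h₀ := Int.fract_nonneg x
  have h₁ := Int.fract_lt_one x
  rcases lt_or_ge (Int.fract x) (1 / 2) with hr | hr
  · have hfl : ⌊x - 1 / 2⌋ = ⌊x⌋ - 1 := by
      rw [Int.floor_eq_iff]
      push_cast
      constructor <;> linarith
    have hfr : Int.fract (2 * x) = 2 * Int.fract x := by
      rw [Int.fract_eq_iff]
      refine ⟨by linarith, by linarith, 2 * ⌊x⌋, ?_⟩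
      push_cast
      linarith
    rw [hfl, hfr, Ne, Int.floor_eq_iff]
    push_cast
    constructor
    · intro h
      refine ⟨?_, by linarith⟩
      by_contra! hlt
      exact h ⟨by linarith, by linarith⟩
    · rintro ⟨h, -⟩ ⟨-, h'⟩
      linarith
  · have hfl : ⌊x - 1 / 2⌋ = ⌊x⌋ := by
      rw [Int.floor_eq_iff]
      constructor <;> linarith
    have hfr : Int.fract (2 * x) = 2 * Int.fract x - 1 := by
      rw [Int.fract_eq_iff]
      refine ⟨by linarith, by linarith, 2 * ⌊x⌋ + 1, ?_⟩
      push_cast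
      linarith
    rw [hfl, hfr, Ne, Int.floor_eq_iff]
    constructor
    · intro h
      exact absurd ⟨by linarith, by linarith⟩ h
    · rintro ⟨h, h'⟩
      linarith

theorem stmt12 (θ : ℝ) (hθ : 1 < θ) (n : ℕ) (hn : 0 < n) :
    n ∈ Atheta θ ↔
      (1 - 2 * f (Real.log θ / n) ≤ Int.fract (2 * n / Real.log θ) ∧
        Int.fract ((n : ℝ) / Real.log θ) < 1 - f (Real.log θ / n)) := by
  have ht : 0 < Real.log θ / n := div_pos (Real.log_pos hθ) (Nat.cast_pos.2 hn)
  have hM : (θ ^ ((n : ℝ))⁻¹ - 1)⁻¹ = (n : ℝ) / Real.log θ - 1 / 2 + f (Real.log θ / n) := by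
    rw [Real.rpow_def_of_pos (by linarith), ← div_eq_mul_inv, f, inv_div]
    ring
  rw [mul_div_assoc, ← floor_sub_half_add_ne_iff (f_nonneg ht) (f_lt_half ht), ← hM]
  exact and_iff_right hn
end
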